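/- arXiv:1101.3153 — 5 statements merged into one kernel-verified Lean document; each statement's English description precedes it below -/
import Mathlib

section
/- Let L be regular with respect to D and TQ. Let Z be a vector field tangent to the constraint submanifold C such that D̃⌟L_Z(ι*ω_L) ⊂ D̃° and L_Z(D̃) ⊂ D̃ (Lie derivatives). Let f be any function on C and Z_f ∈ D̃ the unique vector field with Z_f⌟ι*ω_L − df ∈ D̃°. Then L_Z(Z_f)⌟ι*ω_L − d(Z(f)) ∈ D̃°. If, further, Z(f) = 0, then L_Z(Z_f) = 0, i.e. [Z, Z_f] = 0. -/
/-- The Lie derivative of a 2-form `ω` on the constraint submanifold `C` along a vector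
field `Z`, in the algebraic model where vector fields on `C` are derivations of its
function algebra `FC`:  `(L_Z ω)(X,Y) = Z(ω(X,Y)) − ω([Z,X],Y) − ω(X,[Z,Y])`. -/
def lieDerTwoForm (FC : Type) [CommRing FC] [Algebra ℝ FC]
    (Z : Derivation ℝ FC FC)
    (ω : Derivation ℝ FC FC →ₗ[FC] Derivation ℝ FC FC →ₗ[FC] FC)
    (X Y : Derivation ℝ FC FC) : FC :=
  Z (ω X Y) - ω ⁅Z, X⁆ Y - ω X ⁅Z, Y⁆

/-!
STATEMENT 6 (Proposition `presym` of the paper).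

Algebraic model of the constraint submanifold `C`: `FC` = functions on `C`,
vector fields on `C` = `Derivation ℝ FC FC`, `ω = ι*ω_L`, `Dt = D̃`,
`D̃° = {1-forms ψ : ψ Y = 0 ∀ Y ∈ D̃}`; for a function `f`, `df = (Y ↦ Y f)`.
Regularity of `L` with respect to `D` and `TQ` is recorded by the nondegeneracy of
`ι*ω_L` on `D̃` (the content of Corollary `zero` of the paper, used in the proof).

Let `Z` be a vector field (on `C`) with `D̃⌟L_Z(ι*ω_L) ⊂ D̃°` and `L_Z(D̃) ⊂ D̃`.
Let `f` be any function on `C` and `Z_f ∈ D̃` the corresponding vector field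
(`Z_f⌟ι*ω_L − df ∈ D̃°`).  Then `(L_Z Z_f)⌟ι*ω_L − d(Z f) ∈ D̃°`, and if moreover
`Z f = 0` then `L_Z Z_f = ⁅Z, Z_f⁆ = 0`.
-/
theorem presym_bracket_corresponds_to_Zf
    (FC : Type) [CommRing FC] [Algebra ℝ FC]
    (ω : Derivation ℝ FC FC →ₗ[FC] Derivation ℝ FC FC →ₗ[FC] FC)
    (hω_alt : ∀ X : Derivation ℝ FC FC, ω X X = 0)
    (Dt : Submodule FC (Derivation ℝ FC FC))
    -- regularity of L with respect to D and TQ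
    (hreg : ∀ W ∈ Dt, (∀ Y ∈ Dt, ω W Y = 0) → W = 0)
    (Z : Derivation ℝ FC FC)
    -- D̃⌟L_Z(ι*ω_L) ⊂ D̃°
    (hZω : ∀ Y ∈ Dt, ∀ Y' ∈ Dt, lieDerTwoForm FC Z ω Y Y' = 0)
    -- L_Z(D̃) ⊂ D̃
    (hZD : ∀ Y ∈ Dt, ⁅Z, Y⁆ ∈ Dt)
    (f : FC) (Zf : Derivation ℝ FC FC)
    (hZfmem : Zf ∈ Dt)
    (hZf : ∀ Y ∈ Dt, ω Zf Y - Y f = 0) :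
    (∀ Y ∈ Dt, ω ⁅Z, Zf⁆ Y - Y (Z f) = 0) ∧ (Z f = 0 → ⁅Z, Zf⁆ = 0) := by
  have key : ∀ Y ∈ Dt, ω ⁅Z, Zf⁆ Y - Y (Z f) = 0 := by
    intro Y hY
    have hLie := hZω Zf hZfmem Y hY
    have hbracket := hZf ⁅Z, Y⁆ (hZD Y hY)
    rw [lieDerTwoForm, sub_eq_zero.mp (hZf Y hY)] at hLie
    rw [Derivation.commutator_apply] at hbracket
    linear_combination -hLie - hbracket
  refine ⟨key, fun hZ => hreg _ (hZD Zf hZfmem) fun Y hY => ?_⟩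
  simpa [hZ] using key Y hY
end

section
/- Let L be regular with respect to D and TQ, and suppose the dynamical field Γ of the constrained system satisfies D̃⌟L_Γ(ι*ω_L) ⊂ D̃° and L_Γ(D̃) ⊂ D̃. Then for any first integral f of Γ, the associated vector field Z_f (the unique Z_f ∈ D̃ with Z_f⌟ι*ω_L − df ∈ D̃°) is an infinitesimal symmetry of Γ, i.e. [Z_f, Γ] = 0. -/
/-!
STATEMENT 7 (Corollary `one` of the paper).

Algebraic model: `FC` = functions on `C`, vector fields on `C` = `Derivation ℝ FC FC`,
`ω = ι*ω_L`, `Dt = D̃`, annihilator conditions as indicated; `EC = ι*E_L`.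
Regularity of `L` with respect to `D` and `TQ` is recorded by nondegeneracy of
`ι*ω_L` on `D̃`.

Suppose the dynamical field `Γ` of the constrained system (`Γ ∈ D̃`,
`Γ⌟ι*ω_L + d(ι*E_L) ∈ D̃°`) satisfies `D̃⌟L_Γ(ι*ω_L) ⊂ D̃°` and `L_Γ(D̃) ⊂ D̃`.
Then for any first integral `f` of `Γ`, the associated vector field `Z_f`
(the unique `Z_f ∈ D̃` with `Z_f⌟ι*ω_L − df ∈ D̃°`) is an infinitesimal symmetry
of `Γ`: `⁅Z_f, Γ⁆ = 0`.
-/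
theorem Zf_is_symmetry_when_Gamma_preserves_structure
    (FC : Type) [CommRing FC] [Algebra ℝ FC]
    (ω : Derivation ℝ FC FC →ₗ[FC] Derivation ℝ FC FC →ₗ[FC] FC)
    (hω_alt : ∀ X : Derivation ℝ FC FC, ω X X = 0)
    (Dt : Submodule FC (Derivation ℝ FC FC))
    -- regularity of L with respect to D and TQ
    (hreg : ∀ W ∈ Dt, (∀ Y ∈ Dt, ω W Y = 0) → W = 0)
    (EC : FC)
    -- Γ is the dynamical field of the constrained system
    (Γ : Derivation ℝ FC FC)
    (hΓmem : Γ ∈ Dt)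
    (hΓ : ∀ Y ∈ Dt, ω Γ Y + Y EC = 0)
    -- Γ satisfies the conditions of Proposition `presym`:
    (hΓω : ∀ Y ∈ Dt, ∀ Y' ∈ Dt, lieDerTwoForm FC Γ ω Y Y' = 0)
    (hΓD : ∀ Y ∈ Dt, ⁅Γ, Y⁆ ∈ Dt)
    -- f is a first integral of Γ, with corresponding vector field Z_f
    (f : FC) (hf : Γ f = 0)
    (Zf : Derivation ℝ FC FC)
    (hZfmem : Zf ∈ Dt)
    (hZf : ∀ Y ∈ Dt, ω Zf Y - Y f = 0) :
    ⁅Zf, Γ⁆ = 0 := by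
  have hW : ⁅Γ, Zf⁆ = 0 := by
    refine hreg _ (hΓD Zf hZfmem) fun Y hY => ?_
    have h := hΓω Zf hZfmem Y hY
    rw [lieDerTwoForm, sub_eq_zero.mp (hZf Y hY), sub_eq_zero.mp (hZf _ (hΓD Y hY)),
      Derivation.commutator_apply, hf, map_zero, sub_zero] at h
    linear_combination -h
  rw [← lie_skew, hW, neg_zero]
end

section
/- Let L be regular with respect to D and TQ, let f be a first integral of the constrained dynamical field Γ, and let Z_f be the corresponding vector field (the unique Z_f ∈ D̃ with Z_f⌟ι*ω_L − df ∈ D̃°). If Z_f satisfies D̃⌟L_{Z_f}(ι*ω_L) ⊂ D̃° and L_{Z_f}(D̃) ⊂ D̃, then Z_f is an infinitesimal symmetry of Γ, i.e. [Z_f, Γ] = 0. -/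
/-!
STATEMENT 8 (Corollary `other` of the paper).

Algebraic model: `FC` = functions on `C`, vector fields on `C` = `Derivation ℝ FC FC`,
`ω = ι*ω_L`, `Dt = D̃`, `EC = ι*E_L`; regularity of `L` with respect to `D` and `TQ`
is recorded by nondegeneracy of `ι*ω_L` on `D̃`.

Let `f` be a first integral of the dynamical field `Γ` of the constrained system
(`Γ ∈ D̃`, `Γ⌟ι*ω_L + d(ι*E_L) ∈ D̃°`), and let `Z_f` be the corresponding vector
field (the unique `Z_f ∈ D̃` with `Z_f⌟ι*ω_L − df ∈ D̃°`).  If `Z_f` satisfies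
`D̃⌟L_{Z_f}(ι*ω_L) ⊂ D̃°` and `L_{Z_f}(D̃) ⊂ D̃`, then `Z_f` is an infinitesimal
symmetry of `Γ`: `⁅Z_f, Γ⁆ = 0`.
-/
theorem Zf_is_symmetry_when_Zf_preserves_structure
    (FC : Type) [CommRing FC] [Algebra ℝ FC]
    (ω : Derivation ℝ FC FC →ₗ[FC] Derivation ℝ FC FC →ₗ[FC] FC)
    (hω_alt : ∀ X : Derivation ℝ FC FC, ω X X = 0)
    (Dt : Submodule FC (Derivation ℝ FC FC))
    -- regularity of L with respect to D and TQ
    (hreg : ∀ W ∈ Dt, (∀ Y ∈ Dt, ω W Y = 0) → W = 0)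
    (EC : FC)
    -- Γ is the dynamical field of the constrained system
    (Γ : Derivation ℝ FC FC)
    (hΓmem : Γ ∈ Dt)
    (hΓ : ∀ Y ∈ Dt, ω Γ Y + Y EC = 0)
    -- f is a first integral of Γ, with corresponding vector field Z_f
    (f : FC) (hf : Γ f = 0)
    (Zf : Derivation ℝ FC FC)
    (hZfmem : Zf ∈ Dt)
    (hZf : ∀ Y ∈ Dt, ω Zf Y - Y f = 0)
    -- Z_f satisfies the conditions of Proposition `presym`:
    (hZfω : ∀ Y ∈ Dt, ∀ Y' ∈ Dt, lieDerTwoForm FC Zf ω Y Y' = 0)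
    (hZfD : ∀ Y ∈ Dt, ⁅Zf, Y⁆ ∈ Dt) :
    ⁅Zf, Γ⁆ = 0 := by
  have hZE : Zf EC = 0 := by
    have hskew : ω Zf Γ + ω Γ Zf = 0 := by
      simpa [hω_alt] using hω_alt (Zf + Γ)
    linear_combination hΓ Zf hZfmem - hskew + hZf Γ hΓmem + hf
  refine hreg _ (hZfD Γ hΓmem) fun Y hY => ?_
  have hLie := hZfω Γ hΓmem Y hY
  rw [lieDerTwoForm, eq_neg_of_add_eq_zero_left (hΓ Y hY),
    eq_neg_of_add_eq_zero_left (hΓ _ (hZfD Y hY)), Derivation.commutator_apply, hZE,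
    map_zero, map_neg] at hLie
  linear_combination -hLie
end

section
/- Suppose the constraint distribution D is 2-step maximally nonintegrable, i.e. D + [D,D] equals the whole module of vector fields on Q. Then a vector field Z ∈ D̃ satisfying D̃⌟L_Z(ι*ω_L) ⊂ D̃°, L_Z(D̃) ⊂ D̃ and L_Z(ι*ω_L) ∈ d(D̃°) is a symmetry of ι*ω_L, i.e. L_Z(ι*ω_L) = 0. -/
/-!
STATEMENT 12.

Algebraic model: `FC` = functions on `C`, vector fields on `C` = `Derivation ℝ FC FC`,
`ω = ι*ω_L`, `Dt = D̃`; regularity of `L` with respect to `D` and `TQ` is recorded by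
nondegeneracy of `ι*ω_L` on `D̃`.

Hypothesis `h2step` states that `D̃ + [D̃, D̃]` is the whole module of vector fields
on `C` (which is what 2-step maximal nonintegrability of the constraint distribution
`D`, i.e. `D + [D,D] = 𝔛(Q)`, yields on `C`).

Then a vector field `Z ∈ D̃` satisfying `D̃⌟L_Z(ι*ω_L) ⊂ D̃°`, `L_Z(D̃) ⊂ D̃` and
`L_Z(ι*ω_L) ∈ d(D̃°)` is a symmetry of `ι*ω_L`, i.e. `L_Z(ι*ω_L) = 0`.
-/
theorem two_step_nonintegrable_symmetry_of_omega
    (FC : Type) [CommRing FC] [Algebra ℝ FC]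
    (ω : Derivation ℝ FC FC →ₗ[FC] Derivation ℝ FC FC →ₗ[FC] FC)
    (hω_alt : ∀ X : Derivation ℝ FC FC, ω X X = 0)
    (Dt : Submodule FC (Derivation ℝ FC FC))
    -- regularity of L with respect to D and TQ
    (hreg : ∀ W ∈ Dt, (∀ Y ∈ Dt, ω W Y = 0) → W = 0)
    -- the constraint distribution is 2-step maximally nonintegrable:
    -- D̃ + [D̃,D̃] is the whole module of vector fields on C
    (h2step : Submodule.span FC
        ((Dt : Set (Derivation ℝ FC FC)) ∪
          {W | ∃ Y₁ ∈ Dt, ∃ Y₂ ∈ Dt, W = ⁅Y₁, Y₂⁆}) = ⊤)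
    (Z : Derivation ℝ FC FC)
    (hZmem : Z ∈ Dt)
    -- D̃⌟L_Z(ι*ω_L) ⊂ D̃°
    (hZω : ∀ Y ∈ Dt, ∀ Y' ∈ Dt, lieDerTwoForm FC Z ω Y Y' = 0)
    -- L_Z(D̃) ⊂ D̃
    (hZD : ∀ Y ∈ Dt, ⁅Z, Y⁆ ∈ Dt)
    -- L_Z(ι*ω_L) = dφ for some 1-form φ ∈ D̃°
    (hexact : ∃ φ : Derivation ℝ FC FC →ₗ[FC] FC, (∀ Y ∈ Dt, φ Y = 0) ∧
      ∀ X Y : Derivation ℝ FC FC,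
        lieDerTwoForm FC Z ω X Y = X (φ Y) - Y (φ X) - φ ⁅X, Y⁆) :
    ∀ X Y : Derivation ℝ FC FC, lieDerTwoForm FC Z ω X Y = 0 := by
  obtain ⟨φ, hφ, hdφ⟩ := hexact
  have hker : (⊤ : Submodule FC (Derivation ℝ FC FC)) ≤ LinearMap.ker φ := by
    rw [← h2step, Submodule.span_le]
    rintro W (hW | ⟨Y₁, h₁, Y₂, h₂, rfl⟩)
    · exact hφ W hW
    · have h := hdφ Y₁ Y₂
      rw [hZω Y₁ h₁ Y₂ h₂, hφ Y₁ h₁, hφ Y₂ h₂, map_zero, map_zero, sub_zero, zero_sub] at h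
      exact neg_eq_zero.mp h.symm
  have hzero : ∀ X, φ X = 0 := fun X => hker Submodule.mem_top
  intro X Y
  simp [hdφ, hzero]
end

section
/- Suppose the constraint distribution D is maximally nonintegrable, i.e. the smallest involutive distribution [D] containing D is the whole module of vector fields on Q. Then a vector field Z ∈ D̃ satisfying D̃⌟L_Z(ι*ω_L) = 0, L_Z(D̃) ⊂ D̃ and L_Z(ι*ω_L) ∈ d(D̃°) is a symmetry of ι*ω_L, i.e. L_Z(ι*ω_L) = 0. -/
/-- The smallest involutive distribution (submodule of vector fields closed under
Lie bracket) containing a given distribution `D`, denoted `[D]` in the paper. -/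
def invClosure (A : Type) [CommRing A] [Algebra ℝ A]
    (D : Submodule A (Derivation ℝ A A)) : Submodule A (Derivation ℝ A A) :=
  sInf {E : Submodule A (Derivation ℝ A A) |
    D ≤ E ∧ ∀ X ∈ E, ∀ Y ∈ E, ⁅X, Y⁆ ∈ E}

/-- The vector fields annihilated by a 1-form `φ` along which the Lie derivative of `φ` vanishes
(equivalently, the common kernel of `φ` and `dφ`). -/
def characteristicSubmodule {A : Type} [CommRing A] [Algebra ℝ A]
    (φ : Derivation ℝ A A →ₗ[A] A) : Submodule A (Derivation ℝ A A) where
  carrier := {X | φ X = 0 ∧ ∀ W : Derivation ℝ A A, X (φ W) = φ ⁅X, W⁆}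
  zero_mem' := by simp
  add_mem' := by
    rintro X Y ⟨hX, hX'⟩ ⟨hY, hY'⟩
    exact ⟨by simp [hX, hY], fun W => by simp [hX', hY']⟩
  smul_mem' := by
    rintro f X ⟨hX, hX'⟩
    refine ⟨by simp [hX], fun W => ?_⟩
    have h : ⁅f • X, W⁆ = f • ⁅X, W⁆ - W f • X := by
      ext a
      simp only [Derivation.commutator_apply, Derivation.smul_apply, Derivation.sub_apply,
        smul_eq_mul, Derivation.leibniz]
      ring
    simp [h, hX, hX']

theorem lie_mem_characteristicSubmodule {A : Type} [CommRing A] [Algebra ℝ A]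
    {φ : Derivation ℝ A A →ₗ[A] A} {X Y : Derivation ℝ A A}
    (hX : X ∈ characteristicSubmodule φ) (hY : Y ∈ characteristicSubmodule φ) :
    ⁅X, Y⁆ ∈ characteristicSubmodule φ := by
  obtain ⟨-, hX'⟩ := hX
  obtain ⟨hY, hY'⟩ := hY
  refine ⟨by rw [← hX', hY, map_zero], fun W => ?_⟩
  rw [Derivation.commutator_apply, hY', hX', hX', hY', lie_lie, map_sub]

/-!
STATEMENT 13.

Algebraic model: `FC` = functions on `C`, vector fields on `C` = `Derivation ℝ FC FC`,
`ω = ι*ω_L`, `Dt = D̃`; regularity of `L` with respect to `D` and `TQ` is recorded by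
nondegeneracy of `ι*ω_L` on `D̃`.

Hypothesis `hmaxnonint` states that the smallest involutive distribution containing
`D̃` is the whole module of vector fields on `C` (which is what maximal
nonintegrability of the constraint distribution `D`, i.e. `[D] = 𝔛(Q)`, yields on `C`).

Then a vector field `Z ∈ D̃` satisfying `D̃⌟L_Z(ι*ω_L) = 0`
(i.e. `Y⌟L_Z(ι*ω_L) = 0` for all `Y ∈ D̃`), `L_Z(D̃) ⊂ D̃` and
`L_Z(ι*ω_L) ∈ d(D̃°)` is a symmetry of `ι*ω_L`, i.e. `L_Z(ι*ω_L) = 0`.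
-/
theorem maximally_nonintegrable_symmetry_of_omega
    (FC : Type) [CommRing FC] [Algebra ℝ FC]
    (ω : Derivation ℝ FC FC →ₗ[FC] Derivation ℝ FC FC →ₗ[FC] FC)
    (hω_alt : ∀ X : Derivation ℝ FC FC, ω X X = 0)
    (Dt : Submodule FC (Derivation ℝ FC FC))
    -- regularity of L with respect to D and TQ
    (hreg : ∀ W ∈ Dt, (∀ Y ∈ Dt, ω W Y = 0) → W = 0)
    -- the constraint distribution is maximally nonintegrable: [D̃] = 𝔛(C)
    (hmaxnonint : invClosure FC Dt = ⊤)
    (Z : Derivation ℝ FC FC)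
    (hZmem : Z ∈ Dt)
    -- D̃⌟L_Z(ι*ω_L) = 0
    (hZω : ∀ Y ∈ Dt, ∀ W : Derivation ℝ FC FC, lieDerTwoForm FC Z ω Y W = 0)
    -- L_Z(D̃) ⊂ D̃
    (hZD : ∀ Y ∈ Dt, ⁅Z, Y⁆ ∈ Dt)
    -- L_Z(ι*ω_L) = dφ for some 1-form φ ∈ D̃°
    (hexact : ∃ φ : Derivation ℝ FC FC →ₗ[FC] FC, (∀ Y ∈ Dt, φ Y = 0) ∧
      ∀ X Y : Derivation ℝ FC FC,
        lieDerTwoForm FC Z ω X Y = X (φ Y) - Y (φ X) - φ ⁅X, Y⁆) :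
    ∀ X Y : Derivation ℝ FC FC, lieDerTwoForm FC Z ω X Y = 0 := by
  obtain ⟨φ, hφ, hdφ⟩ := hexact
  have hle : invClosure FC Dt ≤ characteristicSubmodule φ := by
    refine sInf_le ⟨fun Y hY => ⟨hφ Y hY, fun W => ?_⟩,
      fun X hX Y hY => lie_mem_characteristicSubmodule hX hY⟩
    have h := hdφ Y W
    rw [hZω Y hY W, hφ Y hY, map_zero, sub_zero] at h
    exact sub_eq_zero.mp h.symm
  have hzero (X : Derivation ℝ FC FC) : φ X = 0 :=
    (hle (hmaxnonint ▸ Submodule.mem_top : X ∈ invClosure FC Dt)).1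
  intro X Y
  simp [hdφ, hzero]
end
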